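/- arXiv:2006.02475 — 6 statements merged into one kernel-verified Lean document; each statement's English description precedes it below -/
import Mathlib

section
/- Let 0 < ε < 1, let m ≥ 1 be an integer, and let δ be a real with 0 ≤ δ ≤ ε/(1−ε). Then for any nonnegative reals x_1, …, x_m, M_{1+δ}(x_1,…,x_m) ≤ MA_ε(x_1,…,x_m). -/
/-- anti-convexity inequality.
For `0 < ε < 1`, `m ≥ 1` and `0 ≤ δ ≤ ε/(1−ε)`, and nonnegative reals `x₁, …, x_m`,
the power mean `M_{1+δ}(x) = ((∑ i, x i ^ (1+δ))/m)^(1/(1+δ))` is at most the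
ε-max/average `MA_ε(x) = ε·max_i x_i + ((1−ε)/m)·∑ i, x i`. -/
theorem powerMean_le_maxAverage (m : ℕ) (hm : 1 ≤ m) (ε δ : ℝ)
    (hε0 : 0 < ε) (hε1 : ε < 1) (hδ0 : 0 ≤ δ) (hδ : δ ≤ ε / (1 - ε))
    (x : Fin m → ℝ) (hx : ∀ i, 0 ≤ x i) :
    ((∑ i, x i ^ (1 + δ)) / m) ^ (1 / (1 + δ)) ≤
      ε * Finset.univ.sup' ⟨⟨0, hm⟩, Finset.mem_univ _⟩ x + (1 - ε) / m * ∑ i, x i := by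
  set M := Finset.univ.sup' ⟨⟨0, hm⟩, Finset.mem_univ _⟩ x
  have hxM : ∀ i, x i ≤ M := fun i => Finset.le_sup' x (Finset.mem_univ i)
  have hM0 : 0 ≤ M := (hx ⟨0, hm⟩).trans (hxM _)
  have hm0 : (0 : ℝ) < m := by exact_mod_cast hm
  have hδ1 : 0 < 1 + δ := by linarith
  set A := (∑ i, x i) / m with hA
  have hA0 : 0 ≤ A := div_nonneg (Finset.sum_nonneg fun i _ => hx i) hm0.le
  have hAM : A ≤ M := by
    rw [hA, div_le_iff₀ hm0]
    calc ∑ i, x i ≤ ∑ _i : Fin m, M := Finset.sum_le_sum fun i _ => hxM i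
      _ = M * m := by simp [mul_comm]
  have hmean : (∑ i, x i ^ (1 + δ)) / m ≤ M ^ δ * A := by
    rw [hA, ← mul_div_assoc, Finset.mul_sum]
    gcongr with i
    rw [Real.rpow_add_of_nonneg (hx i) zero_le_one hδ0, Real.rpow_one, mul_comm]
    exact mul_le_mul_of_nonneg_right (Real.rpow_le_rpow (hx i) (hxM i) hδ0) (hx i)
  have hθ : δ / (1 + δ) ≤ ε := by
    rw [le_div_iff₀ (by linarith)] at hδ
    rw [div_le_iff₀ hδ1]
    linarith
  have hθ1 : δ / (1 + δ) + 1 / (1 + δ) = 1 := by field_simp; ring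
  calc ((∑ i, x i ^ (1 + δ)) / m) ^ (1 / (1 + δ))
      ≤ (M ^ δ * A) ^ (1 / (1 + δ)) :=
        Real.rpow_le_rpow
          (div_nonneg (Finset.sum_nonneg fun i _ => Real.rpow_nonneg (hx i) _) hm0.le)
          hmean (by positivity)
    _ = M ^ (δ / (1 + δ)) * A ^ (1 / (1 + δ)) := by
        rw [Real.mul_rpow (by positivity) hA0, ← Real.rpow_mul hM0, mul_one_div]
    _ ≤ δ / (1 + δ) * M + 1 / (1 + δ) * A :=
        Real.geom_mean_le_arith_mean2_weighted (by positivity) (by positivity) hM0 hA0 hθ1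
    _ ≤ ε * M + (1 - ε) * A := by
        rw [eq_sub_of_add_eq' hθ1]
        nlinarith [mul_nonneg (sub_nonneg.2 hθ) (sub_nonneg.2 hAM)]
    _ = ε * M + (1 - ε) / m * ∑ i, x i := by rw [hA]; ring
end

section
/- The bound δ ≤ ε/(1−ε) in the anti-convexity inequality is best possible: for every 0 < ε < 1 and every δ > ε/(1−ε), there exists an integer m ≥ 2 such that, taking x_1 = 0 and x_2 = ⋯ = x_m = 1, one has M_{1+δ}(x_1,…,x_m) = ((m−1)/m)^{1/(1+δ)} > ε + (1−ε)·(m−1)/m = MA_ε(x_1,…,x_m). -/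
/-- Bernoulli's inequality for exponents in `[0, 1]`, applied to the reciprocal base. -/
lemma div_add_le_rpow_sub_one_div {a x : ℝ} (ha0 : 0 ≤ a) (ha1 : a ≤ 1) (hx : 1 < x) :
    (x - 1) / (x - 1 + a) ≤ ((x - 1) / x) ^ a := by
  have hx1 : 0 < x - 1 := by linarith
  have hx0 : 0 < x := by linarith
  have hs : 0 ≤ 1 / (x - 1) := by positivity
  have hB := rpow_one_add_le_one_add_mul_self (s := 1 / (x - 1)) (by linarith) ha0 ha1
  have hbase : (x - 1) / x = (1 + 1 / (x - 1))⁻¹ := by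
    field_simp
    ring
  have hbound : (x - 1) / (x - 1 + a) = (1 + a * (1 / (x - 1)))⁻¹ := by
    field_simp
  rw [hbase, hbound, Real.inv_rpow (by positivity)]
  exact inv_anti₀ (by positivity) hB

/-- For `a < c` the tangent-type bound `1 - c / x < (1 - 1 / x) ^ a` holds once `x` is large. -/
lemma one_sub_add_mul_lt_rpow {a c x : ℝ} (ha0 : 0 ≤ a) (ha1 : a ≤ 1) (hac : a < c)
    (hx : 1 < x) (hlarge : c * (1 - a) / (c - a) < x) :
    (1 - c) + c * ((x - 1) / x) < ((x - 1) / x) ^ a := by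
  refine lt_of_lt_of_le ?_ (div_add_le_rpow_sub_one_div ha0 ha1 hx)
  have hx0 : 0 < x := by linarith
  have hxa : 0 < x - 1 + a := by linarith
  have hlhs : (1 - c) + c * ((x - 1) / x) = (x - c) / x := by
    field_simp
    ring
  rw [div_lt_iff₀ (by linarith)] at hlarge
  rw [hlhs, div_lt_div_iff₀ hx0 hxa]
  nlinarith

/-- The vector `(0, 1, …, 1)` of length `m ≥ 1` has coordinate sum `m - 1`. -/
lemma sum_fin_ite_eq_zero {m : ℕ} (hm : 1 ≤ m) :
    ∑ i : Fin m, (if (i : ℕ) = 0 then (0 : ℝ) else 1) = (m : ℝ) - 1 := by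
  obtain ⟨n, rfl⟩ := Nat.exists_eq_add_of_le' hm
  simp [Fin.sum_univ_succ]

/-- The vector `(0, 1, …, 1)` of length `m ≥ 2` has largest coordinate `1`. -/
lemma sup'_fin_ite_eq_zero {m : ℕ} (hm : 2 ≤ m) (h : (Finset.univ : Finset (Fin m)).Nonempty) :
    Finset.univ.sup' h (fun i : Fin m => if (i : ℕ) = 0 then (0 : ℝ) else 1) = 1 := by
  apply le_antisymm
  · refine Finset.sup'_le _ _ fun i _ => ?_
    split_ifs <;> norm_num
  · exact Finset.le_sup'_of_le _ (Finset.mem_univ (⟨1, hm⟩ : Fin m)) (by simp)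

/-- sharpness of the anti-convexity inequality.
For every `0 < ε < 1` and every `δ > ε/(1−ε)`, there is an integer `m ≥ 2` such that,
taking `x₁ = 0` and `x₂ = ⋯ = x_m = 1`, one has
`M_{1+δ}(x) = ((m−1)/m)^(1/(1+δ)) > ε + (1−ε)·(m−1)/m = MA_ε(x)`. -/
theorem maxAverage_bound_best_possible (ε δ : ℝ) (hε0 : 0 < ε) (hε1 : ε < 1)
    (hδ : ε / (1 - ε) < δ) :
    ∃ m : ℕ, ∃ hm : 2 ≤ m,
      (((∑ i : Fin m, (if (i : ℕ) = 0 then (0 : ℝ) else 1) ^ (1 + δ)) / m) ^ (1 / (1 + δ))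
          = (((m : ℝ) - 1) / m) ^ (1 / (1 + δ))) ∧
      (((m : ℝ) - 1) / m) ^ (1 / (1 + δ)) > ε + (1 - ε) * (((m : ℝ) - 1) / m) ∧
      ε + (1 - ε) * (((m : ℝ) - 1) / m)
          = ε * Finset.univ.sup' ⟨⟨0, by omega⟩, Finset.mem_univ _⟩
                (fun i : Fin m => if (i : ℕ) = 0 then (0 : ℝ) else 1)
              + (1 - ε) / m * ∑ i : Fin m, (if (i : ℕ) = 0 then (0 : ℝ) else 1) := by
  have hc : 0 < 1 - ε := by linarith
  have hδ0 : 0 < δ := lt_trans (by positivity) hδ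
  have ha1 : 1 / (1 + δ) ≤ 1 := by
    rw [div_le_one (by linarith)]
    linarith
  have hac : 1 / (1 + δ) < 1 - ε := by
    rw [div_lt_iff₀ hc] at hδ
    rw [div_lt_iff₀ (by linarith)]
    linarith
  obtain ⟨n, hn⟩ := exists_nat_gt ((1 - ε) * (1 - 1 / (1 + δ)) / (1 - ε - 1 / (1 + δ)))
  have hm : 2 ≤ n + 2 := by omega
  refine ⟨n + 2, hm, ?_, ?_, ?_⟩
  · have hpow (i : Fin (n + 2)) : (if (i : ℕ) = 0 then (0 : ℝ) else 1) ^ (1 + δ)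
        = if (i : ℕ) = 0 then (0 : ℝ) else 1 := by
      split_ifs
      · exact Real.zero_rpow (by linarith)
      · exact Real.one_rpow _
    rw [Finset.sum_congr rfl fun i _ => hpow i, sum_fin_ite_eq_zero (by omega)]
  · have hx : (1 : ℝ) < (n + 2 : ℕ) := by exact_mod_cast hm
    have hlarge := hn.trans (show (n : ℝ) < (n + 2 : ℕ) by push_cast; linarith)
    have := one_sub_add_mul_lt_rpow (by positivity) ha1 hac hx hlarge
    rwa [sub_sub_cancel] at this
  · rw [sum_fin_ite_eq_zero (by omega)]
    refine Eq.trans ?_ (congrArg (fun s => ε * s + (1 - ε) / (n + 2 : ℕ) * (((n + 2 : ℕ) : ℝ) - 1))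
      (sup'_fin_ite_eq_zero hm Finset.univ_nonempty)).symm
    ring
end

section
/- Let α > 0 and β ≥ 0, and let G be a finite connected simple graph on n vertices with minimum degree d_min ≥ α·n. Then for any 0 ≤ ε ≤ β/n, any strategy Q = (1−ε)P + εB for the ε-BRW, and any stationary probability vector π_Q of Q, one has π_Q(u) ≤ (1+β)·α^{−2}·π(u) for every vertex u. -/
open Finset

/-- no boosting on everywhere-dense graphs.
Let `G` be a finite connected graph on `n ≥ 2` vertices with minimum degree at least
`α·n`, and let `0 ≤ ε ≤ β/n` (with `ε ≤ 1` so that `Q` is a genuine ε-BRW strategy).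
Then for any strategy `Q = (1−ε)P + εB` of the ε-biased random walk and any stationary
probability vector `π_Q` of `Q`, we have `π_Q(u) ≤ (1+β)·α⁻²·π(u)` for every vertex `u`,
where `π(u) = d(u)/∑_v d(v)` is the stationary distribution of the simple random walk. -/
theorem dense_no_boost {V : Type*} [Fintype V] (G : SimpleGraph V) [DecidableRel G.Adj]
    (hconn : G.Connected) (hn : 2 ≤ Fintype.card V)
    (α β : ℝ) (hα : 0 < α) (hβ : 0 ≤ β)
    (hmin : ∀ v, α * (Fintype.card V : ℝ) ≤ (G.degree v : ℝ))
    (ε : ℝ) (hε0 : 0 ≤ ε) (hε1 : ε ≤ 1) (hεβ : ε ≤ β / (Fintype.card V : ℝ))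
    (B : V → V → ℝ)
    (hB0 : ∀ x y, 0 ≤ B x y) (hBrow : ∀ x, ∑ y, B x y = 1)
    (hBsupp : ∀ x y, 0 < B x y → G.Adj x y)
    (πQ : V → ℝ) (hπ0 : ∀ v, 0 ≤ πQ v) (hπ1 : ∑ v, πQ v = 1)
    (hstat : ∀ y, ∑ x, πQ x *
        ((1 - ε) * (if G.Adj x y then ((G.degree x : ℝ))⁻¹ else 0) + ε * B x y) = πQ y) :
    ∀ u, πQ u ≤ (1 + β) * (α ^ 2)⁻¹ * ((G.degree u : ℝ) / ∑ v, (G.degree v : ℝ)) := by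
  intro u
  have hn0 : (0 : ℝ) < Fintype.card V := by
    have : 0 < Fintype.card V := by omega
    exact_mod_cast this
  have hdeg (v : V) : (G.degree v : ℝ) ≤ Fintype.card V := by
    exact_mod_cast (G.degree_lt_card_verts v).le
  have hα1 : α ≤ 1 := by
    have := (hmin u).trans (hdeg u)
    nlinarith
  have hαn : 0 < α * (Fintype.card V : ℝ) := mul_pos hα hn0
  have hB1 (x y : V) : B x y ≤ 1 :=
    hBrow x ▸ single_le_sum (fun z _ => hB0 x z) (mem_univ y)
  -- every entry of `Q` is at most `(1 + β) / (α n)`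
  have hentry (x : V) :
      (1 - ε) * (if G.Adj x u then ((G.degree x : ℝ))⁻¹ else 0) + ε * B x u
        ≤ (1 + β) / (α * Fintype.card V) := by
    have hP0 : (0 : ℝ) ≤ if G.Adj x u then ((G.degree x : ℝ))⁻¹ else 0 := by
      split_ifs <;> positivity
    have hP : (if G.Adj x u then ((G.degree x : ℝ))⁻¹ else 0) ≤ (α * Fintype.card V)⁻¹ := by
      split_ifs
      · exact inv_anti₀ hαn (hmin x)
      · positivity
    have hεB : ε * B x u ≤ β / (α * Fintype.card V) :=
      calc ε * B x u ≤ ε := mul_le_of_le_one_right hε0 (hB1 x u)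
        _ ≤ β / Fintype.card V := hεβ
        _ ≤ β / (α * Fintype.card V) :=
          div_le_div_of_nonneg_left hβ hαn (mul_le_of_le_one_left hn0.le hα1)
    have hεP := (mul_le_of_le_one_left hP0 (by linarith : 1 - ε ≤ 1)).trans hP
    rw [add_div, one_div]
    exact add_le_add hεP hεB
  have hsum_le : ∑ v, (G.degree v : ℝ) ≤ (Fintype.card V : ℝ) * Fintype.card V := by
    simpa using sum_le_sum fun v (_ : v ∈ univ) => hdeg v
  have hsum_pos : 0 < ∑ v, (G.degree v : ℝ) :=
    sum_pos (fun v _ => hαn.trans_le (hmin v)) ⟨u, mem_univ u⟩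
  calc πQ u ≤ ∑ x, πQ x * ((1 + β) / (α * Fintype.card V)) := by
        rw [← hstat u]
        exact sum_le_sum fun x _ => mul_le_mul_of_nonneg_left (hentry x) (hπ0 x)
    _ = (1 + β) / (α * Fintype.card V) := by rw [← sum_mul, hπ1, one_mul]
    _ = (1 + β) * (α ^ 2)⁻¹ *
        (α * Fintype.card V / ((Fintype.card V : ℝ) * Fintype.card V)) := by field_simp
    _ ≤ (1 + β) * (α ^ 2)⁻¹ * ((G.degree u : ℝ) / ∑ v, (G.degree v : ℝ)) := by
        gcongr
        exact hmin u
end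

section
/- Let V be a finite set, let P and Q be row-stochastic matrices indexed by V, and let 0 < c ≤ 1 be such that Q(u,v) ≥ c·P(u,v) for all u, v ∈ V. Let π_Q be a probability vector with π_Q Q = π_Q, let μ : V → [0,∞), let γ ≥ 0, and let t be a nonnegative integer such that (P^t)(y,x) ≥ γ·μ(x) for all y, x ∈ V. Then π_Q(x) ≥ c^t·γ·μ(x) for every x ∈ V. -/
open Finset

open Matrix in
/-- If `c • P ≤ Q` entrywise, then a nonnegative vector `w` with `w Q = w` dominates
`c ^ n • w P ^ n`. -/
theorem pow_mul_vecMul_pow_le_of_stationary {V : Type*} [Fintype V] [DecidableEq V]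
    {P Q : Matrix V V ℝ} (hP : ∀ u v, 0 ≤ P u v)
    {c : ℝ} (hc : 0 ≤ c) (hPQ : ∀ u v, c * P u v ≤ Q u v)
    {w : V → ℝ} (hw : ∀ v, 0 ≤ w v) (hstat : ∀ v, ∑ u, w u * Q u v = w v) (n : ℕ) (x : V) :
    c ^ n * (w ᵥ* P ^ n) x ≤ w x := by
  induction n generalizing x with
  | zero => simp
  | succ n ih =>
    calc c ^ (n + 1) * (w ᵥ* P ^ (n + 1)) x
        = ∑ u, (c ^ n * (w ᵥ* P ^ n) u) * (c * P u x) := by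
          rw [pow_succ P, ← vecMul_vecMul, vecMul_eq_sum, Finset.sum_apply, mul_sum]
          refine sum_congr rfl fun u _ => ?_
          simp only [Pi.smul_apply, smul_eq_mul]
          ring
      _ ≤ ∑ u, w u * Q u x := sum_le_sum fun u _ =>
          mul_le_mul (ih u) (hPQ u x) (mul_nonneg hc (hP u x)) (hw u)
      _ = w x := hstat x

/-- lower bound on stationary probabilities by comparison.
Let `P, Q` be row-stochastic matrices on a finite set `V` with `Q(u,v) ≥ c·P(u,v)`
for some `0 < c ≤ 1`, let `π_Q` be a stationary probability vector of `Q`, and suppose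
`(P^t)(y,x) ≥ γ·μ(x)` for all `y, x`. Then `π_Q(x) ≥ c^t·γ·μ(x)` for every `x`. -/
theorem stationary_lower_bound {V : Type*} [Fintype V] [DecidableEq V]
    (P Q : Matrix V V ℝ)
    (hP0 : ∀ u v, 0 ≤ P u v) (hProw : ∀ u, ∑ v, P u v = 1)
    (hQ0 : ∀ u v, 0 ≤ Q u v) (hQrow : ∀ u, ∑ v, Q u v = 1)
    (c : ℝ) (hc0 : 0 < c) (hc1 : c ≤ 1) (hcmp : ∀ u v, c * P u v ≤ Q u v)
    (πQ : V → ℝ) (hπ0 : ∀ v, 0 ≤ πQ v) (hπ1 : ∑ v, πQ v = 1)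
    (hstat : ∀ v, ∑ u, πQ u * Q u v = πQ v)
    (μ : V → ℝ) (hμ : ∀ v, 0 ≤ μ v) (γ : ℝ) (hγ : 0 ≤ γ)
    (t : ℕ) (hPt : ∀ y x, γ * μ x ≤ (P ^ t) y x) :
    ∀ x, c ^ t * γ * μ x ≤ πQ x := by
  intro x
  have hmin : γ * μ x ≤ Matrix.vecMul πQ (P ^ t) x := by
    calc γ * μ x = ∑ y, πQ y * (γ * μ x) := by rw [← sum_mul, hπ1, one_mul]
      _ ≤ ∑ y, πQ y * (P ^ t) y x :=
          sum_le_sum fun y _ => mul_le_mul_of_nonneg_left (hPt y x) (hπ0 y)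
  calc c ^ t * γ * μ x = c ^ t * (γ * μ x) := mul_assoc _ _ _
    _ ≤ c ^ t * Matrix.vecMul πQ (P ^ t) x := by gcongr
    _ ≤ πQ x := pow_mul_vecMul_pow_le_of_stationary hP0 hc0.le hcmp hπ0 hstat t x
end

section
/- Let V be a finite set, let P and Q be row-stochastic matrices indexed by V, and let C ≥ 1 be such that Q(u,v) ≤ C·P(u,v) for all u, v ∈ V. Let π_Q be a probability vector with π_Q Q = π_Q, let μ : V → [0,∞), let γ ≥ 0, and let t be a nonnegative integer such that (P^t)(y,x) ≤ γ·μ(x) for all y, x ∈ V. Then π_Q(x) ≤ C^t·γ·μ(x) for every x ∈ V. -/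
open Finset

/-- A vector dominated by `C` times its image under a nonnegative matrix `P` is dominated by
`C ^ n` times its image under `P ^ n`. -/
theorem le_pow_mul_vecMul_pow {V : Type*} [Fintype V] [DecidableEq V] {P : Matrix V V ℝ}
    (hP : ∀ u v, 0 ≤ P u v) {C : ℝ} (hC : 0 ≤ C) {p : V → ℝ}
    (hp : ∀ v, p v ≤ C * ∑ u, p u * P u v) (n : ℕ) (v : V) :
    p v ≤ C ^ n * ∑ u, p u * (P ^ n) u v := by
  induction n generalizing v with
  | zero => simp [Matrix.one_apply]
  | succ n ih =>
    calc p v ≤ C * ∑ w, p w * P w v := hp v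
      _ ≤ C * ∑ w, (C ^ n * ∑ u, p u * (P ^ n) u w) * P w v := by
        gcongr with w
        · exact hP w v
        · exact ih w
      _ = C ^ (n + 1) * ∑ u, p u * (P ^ (n + 1)) u v := by
        simp only [pow_succ, Matrix.mul_apply, Finset.mul_sum, Finset.sum_mul]
        rw [Finset.sum_comm]
        refine Finset.sum_congr rfl fun u _ => Finset.sum_congr rfl fun w _ => ?_
        ring

/-- upper bound on stationary probabilities by comparison.
Let `P, Q` be row-stochastic matrices on a finite set `V` with `Q(u,v) ≤ C·P(u,v)`
for some `C ≥ 1`, let `π_Q` be a stationary probability vector of `Q`, and suppose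
`(P^t)(y,x) ≤ γ·μ(x)` for all `y, x`. Then `π_Q(x) ≤ C^t·γ·μ(x)` for every `x`. -/
theorem stationary_upper_bound {V : Type*} [Fintype V] [DecidableEq V]
    (P Q : Matrix V V ℝ)
    (hP0 : ∀ u v, 0 ≤ P u v) (hProw : ∀ u, ∑ v, P u v = 1)
    (hQ0 : ∀ u v, 0 ≤ Q u v) (hQrow : ∀ u, ∑ v, Q u v = 1)
    (C : ℝ) (hC : 1 ≤ C) (hcmp : ∀ u v, Q u v ≤ C * P u v)
    (πQ : V → ℝ) (hπ0 : ∀ v, 0 ≤ πQ v) (hπ1 : ∑ v, πQ v = 1)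
    (hstat : ∀ v, ∑ u, πQ u * Q u v = πQ v)
    (μ : V → ℝ) (hμ : ∀ v, 0 ≤ μ v) (γ : ℝ) (hγ : 0 ≤ γ)
    (t : ℕ) (hPt : ∀ y x, (P ^ t) y x ≤ γ * μ x) :
    ∀ x, πQ x ≤ C ^ t * γ * μ x := by
  intro x
  have hC0 : 0 ≤ C := zero_le_one.trans hC
  have hsub : ∀ v, πQ v ≤ C * ∑ u, πQ u * P u v := fun v => by
    rw [← hstat v, Finset.mul_sum]
    refine Finset.sum_le_sum fun u _ => ?_
    rw [mul_left_comm]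
    exact mul_le_mul_of_nonneg_left (hcmp u v) (hπ0 u)
  calc πQ x ≤ C ^ t * ∑ y, πQ y * (P ^ t) y x := le_pow_mul_vecMul_pow hP0 hC0 hsub t x
    _ ≤ C ^ t * ∑ y, πQ y * (γ * μ x) := by
      gcongr with y
      · exact hπ0 y
      · exact hPt y x
    _ = C ^ t * γ * μ x := by rw [← Finset.sum_mul, hπ1]; ring
end

section
/- Let G be a finite connected simple graph on n ≥ 2 vertices, let 0 < ε < 1, and let v be any vertex. Set p = π(v) and δ = ln(16·t_mix)/|ln p|, where t_mix is the total variation mixing time of the lazy simple random walk on G. Then there exists a strategy Q = (1−ε)P + εB for the ε-BRW together with a stationary probability vector π_Q of Q such that π_Q(v) ≥ p^{1−ε+δ}; that is, a controller can increase the stationary probability of v from p to p^{1−ε+δ}. -/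
open Finset

/-- The transition matrix of the simple random walk on `G`:
`P(x,y) = 1/d(x)` if `xy ∈ E`, and `0` otherwise. -/
noncomputable def srwMatrix {V : Type*} [Fintype V] (G : SimpleGraph V)
    [DecidableRel G.Adj] : Matrix V V ℝ :=
  Matrix.of fun x y => if G.Adj x y then ((G.degree x : ℝ))⁻¹ else 0

/-- The lazy random walk transition matrix `P̃ = (I + P)/2`. -/
noncomputable def lazyMatrix {V : Type*} [Fintype V] [DecidableEq V] (G : SimpleGraph V)
    [DecidableRel G.Adj] : Matrix V V ℝ :=
  (2 : ℝ)⁻¹ • (1 + srwMatrix G)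

/-- The stationary distribution of the simple random walk on `G`:
`π(x) = d(x)/∑_v d(v)`. -/
noncomputable def srwStationary {V : Type*} [Fintype V] (G : SimpleGraph V)
    [DecidableRel G.Adj] (x : V) : ℝ :=
  (G.degree x : ℝ) / ∑ v, (G.degree v : ℝ)

/-- The total variation mixing time of the lazy random walk on `G`:
`t_mix = min{t ≥ 1 : max_x (1/2)∑_y |(P̃^t)(x,y) − π(y)| ≤ 1/4}`. -/
noncomputable def mixingTime {V : Type*} [Fintype V] [DecidableEq V] (G : SimpleGraph V)
    [DecidableRel G.Adj] : ℕ :=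
  sInf {t : ℕ | 1 ≤ t ∧ ∀ x : V,
    (1 / 2) * ∑ y, |(lazyMatrix G ^ t) x y - srwStationary G y| ≤ 1 / 4}

section StochasticMatrix

variable {V : Type*} [Fintype V] [DecidableEq V]

/-- Every stochastic matrix has a stationary probability vector. -/
theorem exists_stationary_of_mem_rowStochastic [Nonempty V] {Q : Matrix V V ℝ}
    (hQ : Q ∈ Matrix.rowStochastic ℝ V) :
    ∃ μ : V → ℝ, (∀ u, 0 ≤ μ u) ∧ ∑ u, μ u = 1 ∧ ∀ y, ∑ x, μ x * Q x y = μ y := by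
  have hdet : (Q - 1).det = 0 := by
    rw [← Matrix.exists_mulVec_eq_zero_iff]
    exact ⟨1, one_ne_zero, by rw [Matrix.sub_mulVec, hQ.2, Matrix.one_mulVec, sub_self]⟩
  obtain ⟨z, hz0, hz⟩ := Matrix.exists_vecMul_eq_zero_iff.2 hdet
  have hzQ : ∀ y, ∑ x, z x * Q x y = z y := fun y => by
    have h := congrFun hz y
    rw [Matrix.vecMul_sub, Matrix.vecMul_one] at h
    exact sub_eq_zero.1 h
  have hle : ∀ y, |z y| ≤ ∑ x, |z x| * Q x y := fun y => by
    calc |z y| = |∑ x, z x * Q x y| := by rw [hzQ]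
      _ ≤ ∑ x, |z x * Q x y| := abs_sum_le_sum_abs _ _
      _ = ∑ x, |z x| * Q x y := by simp_rw [abs_mul, abs_of_nonneg (hQ.1 _ _)]
  have htotal : ∑ y, |z y| = ∑ y, ∑ x, |z x| * Q x y := by
    rw [sum_comm]
    simp_rw [← mul_sum, Matrix.sum_row_of_mem_rowStochastic hQ, mul_one]
  have heq := (sum_eq_sum_iff_of_le fun y _ => hle y).1 htotal
  have hpos : 0 < ∑ y, |z y| := by
    obtain ⟨y, hy⟩ := Function.ne_iff.1 hz0
    exact sum_pos' (fun _ _ => abs_nonneg _) ⟨y, mem_univ y, abs_pos.2 hy⟩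
  refine ⟨fun u => |z u| / ∑ y, |z y|, fun u => by positivity, ?_, fun y => ?_⟩
  · rw [← sum_div, div_self hpos.ne']
  · simp_rw [div_mul_eq_mul_div]
    rw [← sum_div, ← heq y (mem_univ y)]

/-- If `h` decreases by at least one in expectation away from `v`, the stationary mass of `v` is
controlled by the maximum of `h`. -/
theorem one_le_stationary_mul_of_drift {Q : Matrix V V ℝ} (hQ : Q ∈ Matrix.rowStochastic ℝ V)
    {μ h : V → ℝ} {v : V} {H : ℝ} (hμ0 : ∀ u, 0 ≤ μ u) (hμ1 : ∑ u, μ u = 1)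
    (hμ : ∀ y, ∑ x, μ x * Q x y = μ y) (hv : 0 ≤ h v) (hH : ∀ u, h u ≤ H)
    (hdrift : ∀ u, u ≠ v → 1 + ∑ y, Q u y * h y ≤ h u) :
    1 ≤ μ v * (1 + H) := by
  have hinv : ∑ x, μ x * ∑ y, Q x y * h y = ∑ y, μ y * h y := by
    simp_rw [mul_sum]
    rw [sum_comm]
    refine sum_congr rfl fun y _ => ?_
    rw [← hμ y, sum_mul]
    exact sum_congr rfl fun x _ => by ring
  have hQv : ∑ y, Q v y * h y ≤ H := by
    calc ∑ y, Q v y * h y ≤ ∑ y, Q v y * H :=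
          sum_le_sum fun y _ => mul_le_mul_of_nonneg_left (hH y) (hQ.1 _ _)
      _ = H := by rw [← sum_mul, Matrix.sum_row_of_mem_rowStochastic hQ, one_mul]
  have hpoint : ∀ x, μ x + μ x * ∑ y, Q x y * h y ≤
      μ x * h x + if x = v then μ v * (1 + H) else 0 := fun x => by
    split_ifs with hx
    · subst hx
      nlinarith [mul_le_mul_of_nonneg_left hQv (hμ0 x), mul_nonneg (hμ0 x) hv]
    · nlinarith [mul_le_mul_of_nonneg_left (hdrift x hx) (hμ0 x)]
  have hsum := sum_le_sum fun x (_ : x ∈ univ) => hpoint x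
  rw [sum_add_distrib, sum_add_distrib, sum_ite_eq' univ v, hinv, hμ1] at hsum
  rw [if_pos (mem_univ v)] at hsum
  linarith

/-- A stochastic matrix that dominates a positive multiple of its stationary distribution
contracts functions of mean zero, so its powers converge. -/
theorem tendsto_pow_of_minorization {M : Matrix V V ℝ} (hM : M ∈ Matrix.rowStochastic ℝ V)
    {μ : V → ℝ} (hμ0 : ∀ u, 0 ≤ μ u) (hμ1 : ∑ u, μ u = 1)
    (hμ : ∀ y, ∑ x, μ x * M x y = μ y) {c : ℝ} (hc : 0 < c)
    (hcM : ∀ x y, c * μ y ≤ M x y) (x y : V) :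
    Filter.Tendsto (fun k : ℕ => (M ^ k) x y) Filter.atTop (nhds (μ y)) := by
  have hc1 : c ≤ 1 := by
    have h := sum_le_sum fun y (_ : y ∈ univ) => hcM x y
    rwa [← mul_sum, hμ1, Matrix.sum_row_of_mem_rowStochastic hM, mul_one] at h
  have hstat : ∀ k, ∑ z, μ z * (M ^ k) z y = μ y := fun k => by
    induction k with
    | zero => simp [Matrix.one_apply]
    | succ k ih =>
      rw [pow_succ']
      simp_rw [Matrix.mul_apply, mul_sum]
      rw [sum_comm, ← ih]
      refine sum_congr rfl fun z _ => ?_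
      rw [← hμ z, sum_mul]
      exact sum_congr rfl fun w _ => by ring
  have hbound : ∀ k x, |(M ^ k) x y - μ y| ≤ (1 - c) ^ k := fun k => by
    induction k with
    | zero =>
      intro x
      have hμy : μ y ≤ 1 := hμ1 ▸ single_le_sum (fun u _ => hμ0 u) (mem_univ y)
      rw [pow_zero, pow_zero, Matrix.one_apply, abs_le]
      split_ifs <;> constructor <;> linarith [hμ0 y]
    | succ k ih =>
      intro x
      have hexp : (M ^ (k + 1)) x y - μ y =
          ∑ z, (M x z - c * μ z) * ((M ^ k) z y - μ y) := by
        have h1 : ∑ z, (M x z - c * μ z) * ((M ^ k) z y - μ y) =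
            ∑ z, M x z * (M ^ k) z y - (∑ z, M x z) * μ y
              - c * ∑ z, μ z * (M ^ k) z y + c * ((∑ z, μ z) * μ y) := by
          simp_rw [sum_mul, mul_sum, ← sum_sub_distrib, ← sum_add_distrib]
          exact sum_congr rfl fun z _ => by ring
        rw [h1, hstat, hμ1, Matrix.sum_row_of_mem_rowStochastic hM, pow_succ', Matrix.mul_apply]
        ring
      calc |(M ^ (k + 1)) x y - μ y|
          ≤ ∑ z, |(M x z - c * μ z) * ((M ^ k) z y - μ y)| := hexp ▸ abs_sum_le_sum_abs _ _
        _ ≤ ∑ z, (M x z - c * μ z) * (1 - c) ^ k := sum_le_sum fun z _ => by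
            rw [abs_mul, abs_of_nonneg (sub_nonneg.2 (hcM x z))]
            exact mul_le_mul_of_nonneg_left (ih z) (sub_nonneg.2 (hcM x z))
        _ = (1 - c) ^ (k + 1) := by
            rw [← sum_mul, sum_sub_distrib, ← mul_sum, hμ1,
              Matrix.sum_row_of_mem_rowStochastic hM]
            ring
  rw [tendsto_iff_norm_sub_tendsto_zero]
  exact squeeze_zero (fun _ => norm_nonneg _) (fun k => hbound k x)
    (tendsto_pow_atTop_nhds_zero_of_lt_one (by linarith) (by linarith))

/-- Reversibility passes to powers. -/
theorem reversible_pow {M : Matrix V V ℝ} {μ : V → ℝ}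
    (hrev : ∀ x y, μ x * M x y = μ y * M y x) (t : ℕ) (x y : V) :
    μ x * (M ^ t) x y = μ y * (M ^ t) y x := by
  induction t generalizing x y with
  | zero =>
    simp only [pow_zero, Matrix.one_apply]
    by_cases h : x = y
    · simp [h]
    · simp [h, Ne.symm h]
  | succ t ih =>
    rw [pow_succ M t, Matrix.mul_apply, ← pow_succ, pow_succ', Matrix.mul_apply, mul_sum, mul_sum]
    refine sum_congr rfl fun z _ => ?_
    linear_combination M z y * ih x z + (M ^ t) z x * hrev z y

/-- For a reversible chain, total variation distance `1/4` at time `t` bounds the separation at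
time `2 * t`. -/
theorem quarter_stationary_le_pow_two_mul {M : Matrix V V ℝ} (hM : M ∈ Matrix.rowStochastic ℝ V)
    {μ : V → ℝ} (hμ0 : ∀ u, 0 < μ u) (hμ1 : ∑ u, μ u = 1)
    (hrev : ∀ x y, μ x * M x y = μ y * M y x) {t : ℕ}
    (ht : ∀ x, (1 / 2) * ∑ y, |(M ^ t) x y - μ y| ≤ 1 / 4) (x v : V) :
    μ v / 4 ≤ (M ^ (2 * t)) x v := by
  have hMt : M ^ t ∈ Matrix.rowStochastic ℝ V := pow_mem hM t
  set m : V → ℝ := fun z => min ((M ^ t) x z) ((M ^ t) v z) with hm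
  have hm0 : ∀ z, 0 ≤ m z := fun z => le_min (hMt.1 _ _) (hMt.1 _ _)
  have hmsum : 1 / 2 ≤ ∑ z, m z := by
    have hpoint : ∀ z, (M ^ t) x z + (M ^ t) v z
        - |(M ^ t) x z - μ z| - |(M ^ t) v z - μ z| ≤ 2 * m z := fun z => by
      have h := min_add_max ((M ^ t) x z) ((M ^ t) v z)
      have h' := max_sub_min_eq_abs ((M ^ t) x z) ((M ^ t) v z)
      have h'' := abs_sub_le ((M ^ t) x z) (μ z) ((M ^ t) v z)
      rw [abs_sub_comm (μ z)] at h''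
      rw [abs_sub_comm] at h'
      simp only [hm]
      linarith
    have hsum := sum_le_sum fun z (_ : z ∈ univ) => hpoint z
    rw [sum_sub_distrib, sum_sub_distrib, sum_add_distrib, ← mul_sum,
      Matrix.sum_row_of_mem_rowStochastic hMt, Matrix.sum_row_of_mem_rowStochastic hMt] at hsum
    linarith [ht x, ht v]
  have hcs := sq_sum_div_le_sum_sq_div univ m fun z _ => hμ0 z
  rw [hμ1, div_one] at hcs
  calc μ v / 4 ≤ μ v * ∑ z, m z ^ 2 / μ z := by
        rw [div_eq_mul_one_div]
        exact mul_le_mul_of_nonneg_left (by nlinarith) (hμ0 v).le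
    _ ≤ (M ^ (2 * t)) x v := by
      rw [two_mul, pow_add, Matrix.mul_apply, mul_sum]
      refine sum_le_sum fun z _ => ?_
      have hzv : (M ^ t) z v = μ v * (M ^ t) v z / μ z := by
        rw [reversible_pow hrev t v z, mul_div_cancel_left₀ _ (hμ0 z).ne']
      have hprod : m z ^ 2 ≤ (M ^ t) x z * (M ^ t) v z := by
        rw [sq]
        exact mul_le_mul (min_le_left _ _) (min_le_right _ _) (hm0 z) (hMt.1 _ _)
      calc μ v * (m z ^ 2 / μ z) ≤ μ v * ((M ^ t) x z * (M ^ t) v z / μ z) := by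
            have := hμ0 z
            have := hμ0 v
            gcongr
        _ = (M ^ t) x z * (M ^ t) z v := by rw [hzv]; ring

end StochasticMatrix

section BiasedControl

/-- The weighted power mean of exponent `1 / (1 - ε)` is at most the `ε`-biased combination of the
mean and the maximum. -/
theorem rpow_sum_le_biased {V : Type*} [Fintype V] {w a F : V → ℝ} {ε M : ℝ} (hε0 : 0 < ε)
    (hε1 : ε < 1) (hw : ∀ y, 0 ≤ w y) (ha : ∀ y, 0 ≤ a y)
    (haF : ∀ y, a y ^ (1 - ε) ≤ F y) (hM0 : 0 ≤ M) (hM : ∀ y, w y ≠ 0 → F y ≤ M) :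
    (∑ y, w y * a y) ^ (1 - ε) ≤ (1 - ε) * ∑ y, w y * F y + ε * M := by
  have hθ : 0 < 1 - ε := sub_pos.2 hε1
  have hF0 : ∀ y, 0 ≤ F y := fun y => (Real.rpow_nonneg (ha y) _).trans (haF y)
  have hS0 : 0 ≤ ∑ y, w y * F y := sum_nonneg fun y _ => mul_nonneg (hw y) (hF0 y)
  have hterm : ∀ y, w y * a y ≤ M ^ (ε / (1 - ε)) * (w y * F y) := fun y => by
    by_cases hwy : w y = 0
    · simp [hwy]
    have hpow : a y ^ ε ≤ M ^ (ε / (1 - ε)) := by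
      calc a y ^ ε = (a y ^ (1 - ε)) ^ (ε / (1 - ε)) := by
            rw [← Real.rpow_mul (ha y), mul_div_cancel₀ _ hθ.ne']
        _ ≤ M ^ (ε / (1 - ε)) :=
            Real.rpow_le_rpow (Real.rpow_nonneg (ha y) _) ((haF y).trans (hM y hwy)) (by positivity)
    have hsplit : a y = a y ^ ε * a y ^ (1 - ε) := by
      rw [← Real.rpow_add_of_nonneg (ha y) hε0.le hθ.le, add_sub_cancel, Real.rpow_one]
    calc w y * a y = w y * (a y ^ ε * a y ^ (1 - ε)) := by rw [← hsplit]
      _ ≤ w y * (M ^ (ε / (1 - ε)) * F y) := by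
          refine mul_le_mul_of_nonneg_left ?_ (hw y)
          exact mul_le_mul hpow (haF y) (Real.rpow_nonneg (ha y) _) (Real.rpow_nonneg hM0 _)
      _ = M ^ (ε / (1 - ε)) * (w y * F y) := by ring
  calc (∑ y, w y * a y) ^ (1 - ε)
      ≤ (M ^ (ε / (1 - ε)) * ∑ y, w y * F y) ^ (1 - ε) := by
        refine Real.rpow_le_rpow (sum_nonneg fun y _ => mul_nonneg (hw y) (ha y)) ?_ hθ.le
        rw [mul_sum]
        exact sum_le_sum fun y _ => hterm y
    _ = (∑ y, w y * F y) ^ (1 - ε) * M ^ ε := by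
        rw [Real.mul_rpow (Real.rpow_nonneg hM0 _) hS0, ← Real.rpow_mul hM0,
          div_mul_cancel₀ _ hθ.ne', mul_comm]
    _ ≤ (1 - ε) * ∑ y, w y * F y + ε * M :=
        Real.geom_mean_le_arith_mean2_weighted hθ.le hε0.le hS0 hM0 (by ring)

variable {V : Type*} [Fintype V] [DecidableEq V]

/-- The least expected cost `f` after one `ε`-biased step from `u`, when the controller may move to
any element of `N u`. -/
noncomputable def biasedMin (P : Matrix V V ℝ) (N : V → Finset V) (hN : ∀ u, (N u).Nonempty)
    (ε : ℝ) (f : V → ℝ) (u : V) : ℝ :=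
  (1 - ε) * ∑ y, P u y * f y + ε * (N u).inf' (hN u) f

/-- One step of value iteration for the `ε`-biased walk absorbed at `v`, paying `c` per step. -/
noncomputable def valueStep (P : Matrix V V ℝ) (N : V → Finset V) (hN : ∀ u, (N u).Nonempty)
    (ε : ℝ) (v : V) (c : ℝ) (f : V → ℝ) (u : V) : ℝ :=
  if u = v then 0 else c + biasedMin P N hN ε f u

variable {P : Matrix V V ℝ} {N : V → Finset V} (hN : ∀ u, (N u).Nonempty) {ε : ℝ} {v : V}

theorem biasedMin_le_affine (hP : P ∈ Matrix.rowStochastic ℝ V) (hε0 : 0 < ε) (hε1 : ε < 1)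
    {f g : V → ℝ} {a b : ℝ} (hfg : ∀ u, f u ≤ a + b * g u) (u : V) :
    biasedMin P N hN ε f u ≤ a + b * biasedMin P N hN ε g u := by
  obtain ⟨w, hw, hwg⟩ := exists_mem_eq_inf' (hN u) g
  have hinf : (N u).inf' (hN u) f ≤ a + b * (N u).inf' (hN u) g :=
    hwg ▸ (inf'_le f hw).trans (hfg w)
  have hsum : ∑ y, P u y * f y ≤ a + b * ∑ y, P u y * g y := by
    calc ∑ y, P u y * f y ≤ ∑ y, P u y * (a + b * g y) :=
          sum_le_sum fun y _ => mul_le_mul_of_nonneg_left (hfg y) (hP.1 _ _)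
      _ = (∑ y, P u y) * a + b * ∑ y, P u y * g y := by
          rw [sum_mul, mul_sum, ← sum_add_distrib]
          exact sum_congr rfl fun y _ => by ring
      _ = a + b * ∑ y, P u y * g y := by
          rw [Matrix.sum_row_of_mem_rowStochastic hP, one_mul]
  unfold biasedMin
  nlinarith [mul_le_mul_of_nonneg_left hinf hε0.le,
    mul_le_mul_of_nonneg_left hsum (sub_nonneg.2 hε1.le)]

theorem valueStep_le_affine (hP : P ∈ Matrix.rowStochastic ℝ V) (hε0 : 0 < ε) (hε1 : ε < 1)
    {f g : V → ℝ} {a b c c₁ c₂ : ℝ} (hac : 0 ≤ a + c) (hc : c₁ ≤ c + b * c₂)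
    (hfg : ∀ u, f u ≤ a + b * g u) (u : V) :
    valueStep P N hN ε v c₁ f u ≤ a + c + b * valueStep P N hN ε v c₂ g u := by
  unfold valueStep
  split_ifs
  · simpa using hac
  · linarith [biasedMin_le_affine hN hP hε0 hε1 hfg u]

theorem valueStep_mono (hP : P ∈ Matrix.rowStochastic ℝ V) (hε0 : 0 < ε) (hε1 : ε < 1)
    (c : ℝ) : Monotone (valueStep P N hN ε v c) := fun f g hfg u => by
  simpa using valueStep_le_affine (v := v) (a := 0) (b := 1) (c := 0) (c₁ := c) (c₂ := c) hN hP
    hε0 hε1 (by simp) (by simp) (fun u => by simpa using hfg u) u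

/-- The iterates starting from `1 - Pi.single v 1` are the least probabilities of avoiding `v` up to
a given time; they decrease in time. -/
theorem avoidance_antitone (hP : P ∈ Matrix.rowStochastic ℝ V) (hε0 : 0 < ε) (hε1 : ε < 1) :
    Antitone fun s : ℕ => (valueStep P N hN ε v 0)^[s] (1 - Pi.single v 1) := by
  refine (valueStep_mono hN hP hε0 hε1 0).antitone_iterate_of_map_le fun u => ?_
  by_cases hu : u = v
  · subst hu; simp [valueStep]
  · have h := valueStep_le_affine (v := v) (f := 1 - Pi.single v 1) (g := 0) (a := 1) (b := 0)
      (c := 0) (c₁ := 0) (c₂ := 0) hN hP hε0 hε1 (by simp) (by simp) (fun w => by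
        by_cases hw : w = v
        · subst hw; simp
        · simp [hw]) u
    simpa [hu] using h

/-- An event of reaching `v` that has probability `q` for the (lazy) walk has probability at least
`q ^ (1 - ε)` for an optimally controlled `ε`-biased walk. -/
theorem rpow_lazy_pow_le_one_sub_avoidance (hP : P ∈ Matrix.rowStochastic ℝ V)
    (hPN : ∀ u y, P u y ≠ 0 → y ∈ N u) (hε0 : 0 < ε) (hε1 : ε < 1) {L : Matrix V V ℝ}
    (hL : L = (2 : ℝ)⁻¹ • (1 + P)) (hLs : L ∈ Matrix.rowStochastic ℝ V) (s : ℕ) (u : V) :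
    ((L ^ s) u v) ^ (1 - ε) ≤
      1 - (valueStep P N hN ε v 0)^[s] (1 - Pi.single v 1) u := by
  have hθ : 0 < 1 - ε := sub_pos.2 hε1
  induction s generalizing u with
  | zero =>
    by_cases hu : u = v
    · subst hu; simp
    · simp [hu, Real.zero_rpow hθ.ne']
  | succ s ih =>
    set g := (valueStep P N hN ε v 0)^[s] (1 - Pi.single v 1) with hg
    have hanti := avoidance_antitone hN (v := v) hP hε0 hε1 (Nat.le_succ s) u
    simp only [Function.iterate_succ_apply', ← hg] at hanti ⊢
    have hLs0 : ∀ y, 0 ≤ (L ^ s) y v := fun y => (pow_mem hLs s).1 y v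
    by_cases hu : u = v
    · rw [valueStep, if_pos hu, sub_zero]
      exact Real.rpow_le_one ((pow_mem hLs (s + 1)).1 _ _)
        (Matrix.le_one_of_mem_rowStochastic (pow_mem hLs (s + 1))) hθ.le
    have hrec : (L ^ (s + 1)) u v =
        ((L ^ s) u v + ∑ y, P u y * (L ^ s) y v) / 2 := by
      rw [pow_succ']
      nth_rw 1 [hL]
      rw [smul_mul_assoc, add_mul, one_mul, Matrix.smul_apply, Matrix.add_apply,
        Matrix.mul_apply, smul_eq_mul]
      ring
    obtain ⟨w, hw, hwg⟩ := exists_mem_eq_inf' (hN u) g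
    have hmove : (∑ y, P u y * (L ^ s) y v) ^ (1 - ε) ≤ 1 - valueStep P N hN ε v 0 g u := by
      have h := rpow_sum_le_biased (M := 1 - g w) hε0 hε1 (hP.1 u) hLs0 ih
        ((Real.rpow_nonneg (hLs0 w) _).trans (ih w))
        (fun y hy => by linarith [hwg ▸ inf'_le g (hPN u y hy)])
      simp_rw [mul_sub, sum_sub_distrib, mul_one] at h
      rw [Matrix.sum_row_of_mem_rowStochastic hP] at h
      rw [valueStep, if_neg hu, biasedMin, hwg]
      linarith
    rw [hrec]
    rcases le_total ((L ^ s) u v) (∑ y, P u y * (L ^ s) y v) with hle | hle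
    · refine (Real.rpow_le_rpow ?_ ?_ hθ.le).trans hmove
      · linarith [hLs0 u]
      · linarith
    · refine (Real.rpow_le_rpow ?_ ?_ hθ.le).trans ((ih u).trans (sub_le_sub_left hanti 1))
      · linarith [hLs0 u, sum_nonneg fun y (_ : y ∈ univ) => mul_nonneg (hP.1 u y) (hLs0 y)]
      · linarith

theorem iterate_valueStep_self (x : V) (k : ℕ) :
    (valueStep P N hN ε x 1)^[k] 0 x = 0 := by
  cases k with
  | zero => rfl
  | succ k => rw [Function.iterate_succ_apply', valueStep, if_pos rfl]

theorem monotone_truncated_hitting (hP : P ∈ Matrix.rowStochastic ℝ V) (hε0 : 0 < ε)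
    (hε1 : ε < 1) : Monotone fun k : ℕ => (valueStep P N hN ε v 1)^[k] 0 := by
  refine (valueStep_mono hN hP hε0 hε1 1).monotone_iterate_of_le_map fun u => ?_
  by_cases hu : u = v
  · simp [valueStep, hu]
  · simp [valueStep, biasedMin, hu]

/-- If `v` can be reached within `s` steps with probability at least `q` from everywhere, the
optimal expected hitting times truncated at any horizon are at most `s / q`. -/
theorem truncated_hitting_le (hP : P ∈ Matrix.rowStochastic ℝ V) (hε0 : 0 < ε) (hε1 : ε < 1)
    {s : ℕ} {q : ℝ} (hq0 : 0 < q)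
    (hq : ∀ u, q ≤ 1 - (valueStep P N hN ε v 0)^[s] (1 - Pi.single v 1) u) (k : ℕ) (u : V) :
    (valueStep P N hN ε v 1)^[k] 0 u ≤ s / q := by
  have hmono := monotone_truncated_hitting hN (v := v) hP hε0 hε1
  have : Nonempty V := ⟨v⟩
  obtain ⟨w, -, hw⟩ := exists_max_image univ ((valueStep P N hN ε v 1)^[k] 0) univ_nonempty
  set H := (valueStep P N hN ε v 1)^[k] 0 w with hH
  have hH0 : 0 ≤ H := hmono (Nat.zero_le k) w
  have hstep : ∀ (j : ℕ) (x : V), (valueStep P N hN ε v 1)^[k + j] 0 x ≤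
      j + H * (valueStep P N hN ε v 0)^[j] (1 - Pi.single v 1) x := fun j => by
    induction j with
    | zero =>
      intro x
      by_cases hx : x = v
      · subst hx
        simpa using (iterate_valueStep_self hN (P := P) (ε := ε) x k).le
      · simpa [hx] using hw x (mem_univ x)
    | succ j ih =>
      intro x
      rw [← add_assoc, Function.iterate_succ_apply', Function.iterate_succ_apply', Nat.cast_succ]
      exact valueStep_le_affine hN hP hε0 hε1 (by positivity) (by simp) ih x
  have hw' := (hmono (Nat.le_add_right k s) w).trans (hstep s w)
  have hHq : H * q ≤ s := by
    have := mul_le_mul_of_nonneg_left (hq w) hH0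
    simp only [← hH] at hw'
    linarith
  exact (hw u (mem_univ u)).trans ((le_div_iff₀ hq0).2 hHq)

/-- The limit of value iteration: an optimal stationary strategy `b` together with a function `h`
dominating its expected hitting times of `v`. -/
theorem exists_strategy_hitting_le (hP : P ∈ Matrix.rowStochastic ℝ V) (hε0 : 0 < ε)
    (hε1 : ε < 1) {s : ℕ} {q : ℝ} (hq0 : 0 < q)
    (hq : ∀ u, q ≤ 1 - (valueStep P N hN ε v 0)^[s] (1 - Pi.single v 1) u) :
    ∃ (b : V → V) (h : V → ℝ), (∀ u, b u ∈ N u) ∧ 0 ≤ h v ∧ (∀ u, h u ≤ s / q) ∧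
      ∀ u, u ≠ v → 1 + ((1 - ε) * ∑ y, P u y * h y + ε * h (b u)) ≤ h u := by
  have hmono := monotone_truncated_hitting hN (v := v) hP hε0 hε1
  have hbdd := truncated_hitting_le hN (v := v) hP hε0 hε1 hq0 hq
  set f : ℕ → V → ℝ := fun k => (valueStep P N hN ε v 1)^[k] 0 with hf
  have hbdd' : ∀ u, BddAbove (Set.range fun k => f k u) := fun u =>
    ⟨s / q, Set.forall_mem_range.2 fun k => hbdd k u⟩
  set h : V → ℝ := fun u => ⨆ k, f k u with hh
  have htend : ∀ u, Filter.Tendsto (fun k => f k u) Filter.atTop (nhds (h u)) := fun u =>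
    tendsto_atTop_ciSup (fun _ _ hkl => hmono hkl u) (hbdd' u)
  choose b hb hbh using fun u => exists_mem_eq_inf' (hN u) h
  refine ⟨b, h, hb, le_ciSup (hbdd' v) 0, fun u => ciSup_le fun k => hbdd k u, fun u hu => ?_⟩
  have hlim : Filter.Tendsto (fun k => 1 + biasedMin P N hN ε (f k) u) Filter.atTop
      (nhds (1 + biasedMin P N hN ε h u)) := by
    unfold biasedMin
    refine ((Filter.Tendsto.const_mul _ (tendsto_finsetSum _ fun y _ =>
      (htend y).const_mul _)).add (Filter.Tendsto.const_mul _ ?_)).const_add _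
    exact Filter.Tendsto.finset_inf'_nhds_apply (hN u) fun y _ => htend y
  rw [← hbh u]
  refine le_of_tendsto hlim (Filter.Eventually.of_forall fun k => ?_)
  have hk := le_ciSup (hbdd' u) (k + 1)
  simp only [hf, Function.iterate_succ_apply'] at hk
  rwa [valueStep, if_neg hu] at hk

end BiasedControl

section LazyWalk

variable {V : Type*} [Fintype V] {G : SimpleGraph V} [DecidableRel G.Adj]

theorem srwStationary_pos (hdeg : ∀ u, 0 < G.degree u) (x : V) : 0 < srwStationary G x :=
  div_pos (by exact_mod_cast hdeg x)
    (sum_pos (fun u _ => by exact_mod_cast hdeg u) ⟨x, mem_univ x⟩)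

theorem sum_srwStationary [Nonempty V] (hdeg : ∀ u, 0 < G.degree u) :
    ∑ x, srwStationary G x = 1 := by
  simp only [srwStationary]
  rw [← sum_div, div_self]
  exact (sum_pos (fun u _ => by exact_mod_cast hdeg u) univ_nonempty).ne'

theorem srwStationary_lt_one [Nontrivial V] (hdeg : ∀ u, 0 < G.degree u) (x : V) :
    srwStationary G x < 1 := by
  obtain ⟨y, hy⟩ := exists_ne x
  rw [← sum_srwStationary hdeg]
  exact single_lt_sum hy (mem_univ x) (mem_univ y) (srwStationary_pos hdeg y)
    fun z _ _ => (srwStationary_pos hdeg z).le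

variable [DecidableEq V]

theorem srwMatrix_mem_rowStochastic (hdeg : ∀ u, 0 < G.degree u) :
    srwMatrix G ∈ Matrix.rowStochastic ℝ V := by
  rw [Matrix.mem_rowStochastic_iff_sum]
  refine ⟨fun x y => ?_, fun x => ?_⟩
  · simp only [srwMatrix, Matrix.of_apply]
    split_ifs <;> positivity
  · have hx : (G.degree x : ℝ) ≠ 0 := by exact_mod_cast (hdeg x).ne'
    simp only [srwMatrix, Matrix.of_apply]
    rw [← sum_filter, ← G.neighborFinset_eq_filter, sum_const, G.card_neighborFinset_eq_degree,
      nsmul_eq_mul, mul_inv_cancel₀ hx]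

theorem lazyMatrix_mem_rowStochastic (hdeg : ∀ u, 0 < G.degree u) :
    lazyMatrix G ∈ Matrix.rowStochastic ℝ V := by
  have h := Matrix.convex_rowStochastic (one_mem (Matrix.rowStochastic ℝ V))
    (srwMatrix_mem_rowStochastic hdeg) (a := (2 : ℝ)⁻¹) (b := (2 : ℝ)⁻¹)
    (by norm_num) (by norm_num) (by norm_num)
  rwa [← smul_add] at h

theorem lazyMatrix_apply (x y : V) :
    lazyMatrix G x y = (2 : ℝ)⁻¹ * ((1 : Matrix V V ℝ) x y + srwMatrix G x y) := rfl

theorem lazyMatrix_reversible (hdeg : ∀ u, 0 < G.degree u) (x y : V) :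
    srwStationary G x * lazyMatrix G x y = srwStationary G y * lazyMatrix G y x := by
  have hne : ∀ u, (G.degree u : ℝ) ≠ 0 := fun u => by exact_mod_cast (hdeg u).ne'
  by_cases hxy : x = y
  · rw [hxy]
  simp only [lazyMatrix_apply, Matrix.one_apply_ne hxy, Matrix.one_apply_ne (Ne.symm hxy),
    srwMatrix, Matrix.of_apply, srwStationary, G.adj_comm y x]
  split_ifs
  · have hx := hne x
    have hy := hne y
    simp only [zero_add]
    field_simp
  · simp

theorem lazyMatrix_pos_self (hdeg : ∀ u, 0 < G.degree u) (x : V) : 0 < lazyMatrix G x x := by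
  rw [lazyMatrix_apply, Matrix.one_apply_eq]
  linarith [(srwMatrix_mem_rowStochastic hdeg).1 x x]

theorem lazyMatrix_pos_of_adj (hdeg : ∀ u, 0 < G.degree u) {x y : V} (hxy : G.Adj x y) :
    0 < lazyMatrix G x y := by
  have hx : (0 : ℝ) < G.degree x := by exact_mod_cast hdeg x
  rw [lazyMatrix_apply, Matrix.one_apply_ne hxy.ne, srwMatrix, Matrix.of_apply, if_pos hxy]
  positivity

theorem lazyMatrix_pow_succ_pos (hdeg : ∀ u, 0 < G.degree u) {x y z : V} {t : ℕ}
    (hxy : 0 < lazyMatrix G x y) (hyz : 0 < (lazyMatrix G ^ t) y z) :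
    0 < (lazyMatrix G ^ (t + 1)) x z := by
  have hL := lazyMatrix_mem_rowStochastic hdeg
  rw [pow_succ', Matrix.mul_apply]
  exact sum_pos' (fun w _ => mul_nonneg (hL.1 _ _) ((pow_mem hL t).1 _ _))
    ⟨y, mem_univ y, mul_pos hxy hyz⟩

theorem lazyMatrix_pow_pos_of_le (hdeg : ∀ u, 0 < G.degree u) {x y : V} {s t : ℕ} (hst : s ≤ t)
    (h : 0 < (lazyMatrix G ^ s) x y) : 0 < (lazyMatrix G ^ t) x y := by
  induction t, hst using Nat.le_induction with
  | base => exact h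
  | succ t _ ih => exact lazyMatrix_pow_succ_pos hdeg (lazyMatrix_pos_self hdeg x) ih

theorem lazyMatrix_pow_length_pos (hdeg : ∀ u, 0 < G.degree u) {x y : V} (p : G.Walk x y) :
    0 < (lazyMatrix G ^ p.length) x y := by
  induction p with
  | nil => simp
  | cons hadj p ih => exact lazyMatrix_pow_succ_pos hdeg (lazyMatrix_pos_of_adj hdeg hadj) ih

theorem exists_lazyMatrix_pow_pos (hconn : G.Connected) (hdeg : ∀ u, 0 < G.degree u) :
    ∃ m : ℕ, ∀ x y, 0 < (lazyMatrix G ^ m) x y := by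
  have hwalk : ∀ z : V × V, ∃ t : ℕ, 0 < (lazyMatrix G ^ t) z.1 z.2 := fun z =>
    (hconn.preconnected z.1 z.2).elim fun p => ⟨_, lazyMatrix_pow_length_pos hdeg p⟩
  choose τ hτ using hwalk
  exact ⟨univ.sup τ, fun x y =>
    lazyMatrix_pow_pos_of_le hdeg (le_sup (mem_univ (x, y))) (hτ (x, y))⟩

/-- The lazy walk on a connected graph mixes, so the infimum defining `mixingTime` is attained. -/
theorem mixingTime_spec [Nontrivial V] (hconn : G.Connected) :
    1 ≤ mixingTime G ∧ ∀ x : V, (1 / 2) *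
      ∑ y, |(lazyMatrix G ^ mixingTime G) x y - srwStationary G y| ≤ 1 / 4 := by
  have hdeg : ∀ u, 0 < G.degree u := fun u => hconn.preconnected.degree_pos_of_nontrivial u
  have hL := lazyMatrix_mem_rowStochastic hdeg
  obtain ⟨m, hm⟩ := exists_lazyMatrix_pow_pos hconn hdeg
  have hMs : lazyMatrix G ^ m ∈ Matrix.rowStochastic ℝ V := pow_mem hL m
  obtain ⟨z, -, hz⟩ := exists_min_image univ
    (fun z : V × V => (lazyMatrix G ^ m) z.1 z.2) univ_nonempty
  have hstat : ∀ y, ∑ x, srwStationary G x * (lazyMatrix G ^ m) x y = srwStationary G y :=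
    fun y => by
      simp_rw [fun x => reversible_pow (lazyMatrix_reversible hdeg) m x y]
      rw [← mul_sum, Matrix.sum_row_of_mem_rowStochastic hMs, mul_one]
  have htend := tendsto_pow_of_minorization hMs (fun u => (srwStationary_pos hdeg u).le)
    (sum_srwStationary hdeg) hstat (hm z.1 z.2) fun x y =>
      (mul_le_of_le_one_right (hm z.1 z.2).le (srwStationary_lt_one hdeg y).le).trans
        (hz (x, y) (mem_univ _))
  have hdist : ∀ x, Filter.Tendsto (fun k : ℕ => (1 / 2 : ℝ) *
      ∑ y, |((lazyMatrix G ^ m) ^ k) x y - srwStationary G y|) Filter.atTop (nhds 0) := fun x => by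
    have h := (tendsto_finsetSum univ fun y _ =>
      ((htend x y).sub_const (srwStationary G y)).abs).const_mul (1 / 2 : ℝ)
    simpa using h
  have hev : ∀ᶠ k in Filter.atTop, ∀ x, (1 / 2 : ℝ) *
      ∑ y, |((lazyMatrix G ^ m) ^ k) x y - srwStationary G y| ≤ 1 / 4 :=
    Filter.eventually_all.2 fun x => (hdist x).eventually_le_const (by norm_num)
  obtain ⟨k, hk, hk1⟩ := (hev.and (Filter.eventually_ge_atTop 1)).exists
  have hm1 : 1 ≤ m := by
    obtain ⟨x, y, hxy⟩ := exists_pair_ne V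
    by_contra hlt
    have h := hm x y
    rw [Nat.lt_one_iff.1 (not_le.1 hlt), pow_zero, Matrix.one_apply_ne hxy] at h
    exact h.false
  exact Nat.sInf_mem (s := {t : ℕ | 1 ≤ t ∧ ∀ x : V,
    (1 / 2) * ∑ y, |(lazyMatrix G ^ t) x y - srwStationary G y| ≤ 1 / 4})
    ⟨m * k, Nat.mul_pos hm1 hk1, fun x => by simpa only [pow_mul] using hk x⟩

end LazyWalk

/-- The numerical form of the bound: `p ^ (ln c / |ln p|) = 1 / c`. -/
theorem rpow_log_div_abs_log {p c : ℝ} (hp0 : 0 < p) (hp1 : p < 1) (hc : 0 < c) :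
    p ^ (Real.log c / |Real.log p|) = c⁻¹ := by
  have hlog : Real.log p < 0 := Real.log_neg hp0 hp1
  rw [Real.rpow_def_of_pos hp0, abs_of_neg hlog, div_neg, mul_neg,
    mul_div_cancel₀ _ hlog.ne, Real.exp_neg, Real.exp_log hc]

/-- Theorem 4.4 of the paper: progress on the ABKLP conjecture.
Let `G` be a finite connected graph on `n ≥ 2` vertices, `0 < ε < 1` and `v` a vertex.
Set `p = π(v)` and `δ = ln(16·t_mix)/|ln p|`.  Then there is a strategy
`Q = (1−ε)P + εB` for the ε-BRW and a stationary probability vector `π_Q` of `Q`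
with `π_Q(v) ≥ p^(1−ε+δ)`. -/
theorem boost_stationary_via_mixing {V : Type*} [Fintype V] [DecidableEq V]
    (G : SimpleGraph V) [DecidableRel G.Adj] (hconn : G.Connected)
    (hn : 2 ≤ Fintype.card V) (ε : ℝ) (hε0 : 0 < ε) (hε1 : ε < 1) (v : V) :
    ∃ B : V → V → ℝ, ∃ πQ : V → ℝ,
      (∀ x y, 0 ≤ B x y) ∧ (∀ x, ∑ y, B x y = 1) ∧
      (∀ x y, 0 < B x y → G.Adj x y) ∧
      (∀ u, 0 ≤ πQ u) ∧ (∑ u, πQ u = 1) ∧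
      (∀ y, ∑ x, πQ x *
          ((1 - ε) * (if G.Adj x y then ((G.degree x : ℝ))⁻¹ else 0) + ε * B x y) = πQ y) ∧
      srwStationary G v ^
          (1 - ε + Real.log (16 * (mixingTime G : ℝ)) / |Real.log (srwStationary G v)|)
        ≤ πQ v := by
  have : Nontrivial V := Fintype.one_lt_card_iff_nontrivial.1 hn
  have hdeg : ∀ u, 0 < G.degree u := fun u => hconn.preconnected.degree_pos_of_nontrivial u
  have hP := srwMatrix_mem_rowStochastic hdeg
  have hL := lazyMatrix_mem_rowStochastic hdeg
  have hN : ∀ u, (G.neighborFinset u).Nonempty := fun u =>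
    card_pos.1 (by simpa only [G.card_neighborFinset_eq_degree] using hdeg u)
  have hPN : ∀ u y, srwMatrix G u y ≠ 0 → y ∈ G.neighborFinset u := fun u y huy => by
    rw [G.mem_neighborFinset]
    by_contra hadj
    exact huy (if_neg hadj)
  obtain ⟨ht1, ht⟩ := mixingTime_spec hconn
  set t := mixingTime G
  have hp0 := srwStationary_pos hdeg v
  have hp1 := srwStationary_lt_one hdeg v
  set p := srwStationary G v
  have hθ : 0 < 1 - ε := sub_pos.2 hε1
  have hreach : ∀ u, (p / 4) ^ (1 - ε) ≤ 1 - (valueStep (srwMatrix G) (fun u => G.neighborFinset u)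
      hN ε v 0)^[2 * t] (1 - Pi.single v 1) u := fun u =>
    (Real.rpow_le_rpow (by positivity) (quarter_stationary_le_pow_two_mul hL
      (srwStationary_pos hdeg) (sum_srwStationary hdeg) (lazyMatrix_reversible hdeg) ht u v)
      hθ.le).trans (rpow_lazy_pow_le_one_sub_avoidance hN hP hPN hε0 hε1 rfl hL (2 * t) u)
  obtain ⟨b, h, hb, hv, hH, hdrift⟩ :=
    exists_strategy_hitting_le hN hP hε0 hε1 (by positivity) hreach
  set B : Matrix V V ℝ := Matrix.of fun x y => if y = b x then 1 else 0 with hB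
  have hBs : B ∈ Matrix.rowStochastic ℝ V := by
    rw [Matrix.mem_rowStochastic_iff_sum]
    refine ⟨fun x y => ?_, fun x => by simp [hB]⟩
    simp only [hB, Matrix.of_apply]
    split_ifs <;> norm_num
  have hQ : (1 - ε) • srwMatrix G + ε • B ∈ Matrix.rowStochastic ℝ V :=
    Matrix.convex_rowStochastic hP hBs hθ.le hε0.le (by ring)
  obtain ⟨μ, hμ0, hμ1, hμ⟩ := exists_stationary_of_mem_rowStochastic hQ
  refine ⟨B, μ, hBs.1, Matrix.sum_row_of_mem_rowStochastic hBs, fun x y hxy => ?_, hμ0, hμ1, hμ, ?_⟩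
  · simp only [hB, Matrix.of_apply] at hxy
    split_ifs at hxy with hy
    · exact hy ▸ (G.mem_neighborFinset x _).1 (hb x)
    · exact absurd hxy (lt_irrefl 0)
  have hmass := one_le_stationary_mul_of_drift hQ hμ0 hμ1 hμ hv hH fun u hu => by
    refine le_of_eq_of_le ?_ (hdrift u hu)
    simp [hB, add_mul, sum_add_distrib, mul_sum, mul_assoc]
  have ht1' : (1 : ℝ) ≤ t := by exact_mod_cast ht1
  rw [Real.rpow_add hp0, rpow_log_div_abs_log hp0 hp1 (by positivity), ← div_eq_mul_inv,
    div_le_iff₀ (by positivity)]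
  set r := p ^ (1 - ε)
  have hr0 : 0 < r := Real.rpow_pos_of_pos hp0 _
  have hr1 : r ≤ 1 := Real.rpow_le_one hp0.le hp1.le hθ.le
  have hq : r / 4 ≤ (p / 4) ^ (1 - ε) := by
    rw [Real.div_rpow hp0.le (by norm_num)]
    refine div_le_div_of_nonneg_left hr0.le (by positivity) ?_
    exact (Real.rpow_le_rpow_of_exponent_le (by norm_num) (by linarith)).trans_eq (Real.rpow_one 4)
  have hcost : 1 + ((2 * t : ℕ) : ℝ) / (p / 4) ^ (1 - ε) ≤ 16 * t / r := by
    have h1 : ((2 * t : ℕ) : ℝ) / (p / 4) ^ (1 - ε) ≤ 8 * t / r := by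
      refine (div_le_div_of_nonneg_left (by positivity) (by positivity) hq).trans_eq ?_
      push_cast
      field_simp
      ring
    have h2 : 1 ≤ 8 * t / r := (one_le_div hr0).2 (by linarith)
    calc _ ≤ 8 * t / r + 8 * t / r := add_le_add h2 h1
      _ = 16 * t / r := by ring
  have hfinal := hmass.trans (mul_le_mul_of_nonneg_left hcost (hμ0 v))
  rwa [← mul_div_assoc, one_le_div hr0] at hfinal
end
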